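/- arXiv:2208.00303 — 3 statements merged into one kernel-verified Lean document; each statement's English description precedes it below -/
import Mathlib

section
/- Let V be the 23×23 matrix over ℤ[q] whose rows and columns are indexed, in order, by the following 23 subsets of {1,2,3,4,5}: first {5},{1,5},{2,5},{3,5},{4,5},{1,2,5},{2,3,5},{3,4,5},{1,4,5}; then ∅,{1},{2},{3},{4},{1,2},{2,3},{3,4},{1,4}; then {1,2,3},{2,3,4},{1,3,4},{1,2,4},{1,2,3,4}; with (S,T) entry q^{|S Δ T|}. Let P be the 23×23 block matrix P = [[I_9, −q·I_9, 0],[0, I_9, 0],[0, 0, I_5]]. Then P V P^t is the block diagonal matrix diag((1−q²)·V′, V″), where V′ is the 9×9 matrix with rows and columns indexed by ∅,{1},{2},{3},{4},{1,2},{2,3},{3,4},{1,4} and (S,T) entry q^{|S Δ T|} (which equals the q-Varchenko matrix of the cyclic model C_4), and V″ is the 14×14 matrix with rows and columns indexed by ∅,{1},{2},{3},{4},{1,2},{2,3},{3,4},{1,4},{1,2,3},{2,3,4},{1,3,4},{1,2,4},{1,2,3,4} and (S,T) entry q^{|S Δ T|}. -/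
open Matrix

noncomputable section

/-- The indeterminate `q` of `ℤ[q]`. -/
def q : Polynomial ℤ := Polynomial.X

/-- The `23` subsets of `{1,…,5}` (rendered as `Fin 5 = {0,…,4}`, the base plane `h₅`
being `4`) indexing the regions of the square-base pyramid arrangement, in the order
of the paper: `5, 15, 25, 35, 45, 125, 235, 345, 145`; then
`∅, 1, 2, 3, 4, 12, 23, 34, 14`; then `123, 234, 134, 124, 1234`. -/
def pyr4Sets : Fin 23 → Finset (Fin 5) :=
  ![{4}, {0, 4}, {1, 4}, {2, 4}, {3, 4}, {0, 1, 4}, {1, 2, 4}, {2, 3, 4}, {0, 3, 4},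
    ∅, {0}, {1}, {2}, {3}, {0, 1}, {1, 2}, {2, 3}, {0, 3},
    {0, 1, 2}, {1, 2, 3}, {0, 2, 3}, {0, 1, 3}, {0, 1, 2, 3}]

/-- The `q`-Varchenko matrix of the square-base pyramid arrangement: the `(S,T)`
entry is `q^|S Δ T|`. -/
def Vpyr4 : Matrix (Fin 23) (Fin 23) (Polynomial ℤ) :=
  Matrix.of fun i j => q ^ (symmDiff (pyr4Sets i) (pyr4Sets j)).card

/-- The block matrix `P = [[I₉, -q·I₉, 0], [0, I₉, 0], [0, 0, I₅]]`. -/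
def Ppyr4 : Matrix (Fin 23) (Fin 23) (Polynomial ℤ) :=
  Matrix.of fun i j =>
    if i = j then 1
    else if (i : ℕ) < 9 ∧ (j : ℕ) = (i : ℕ) + 9 then -q
    else 0

/-- The `9` subsets of `{1,2,3,4}` (as `Fin 4`) indexing the regions of the restricted
arrangement in `h₅` (the cyclic model `C₄`): `∅, 1, 2, 3, 4, 12, 23, 34, 14`. -/
def resSets : Fin 9 → Finset (Fin 4) :=
  ![∅, {0}, {1}, {2}, {3}, {0, 1}, {1, 2}, {2, 3}, {0, 3}]

/-- The `q`-Varchenko matrix `V′` of the restricted arrangement (the cyclic model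
`C₄`): the `(S,T)` entry is `q^|S Δ T|`. -/
def Vres4 : Matrix (Fin 9) (Fin 9) (Polynomial ℤ) :=
  Matrix.of fun i j => q ^ (symmDiff (resSets i) (resSets j)).card

/-- The `14` subsets of `{1,2,3,4}` (as `Fin 4`) indexing the regions of the deleted
arrangement (the four side planes): `∅, 1, 2, 3, 4, 12, 23, 34, 14, 123, 234, 134,
124, 1234`. -/
def delSets : Fin 14 → Finset (Fin 4) :=
  ![∅, {0}, {1}, {2}, {3}, {0, 1}, {1, 2}, {2, 3}, {0, 3},
    {0, 1, 2}, {1, 2, 3}, {0, 2, 3}, {0, 1, 3}, {0, 1, 2, 3}]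

/-- The `q`-Varchenko matrix `V″` of the deleted arrangement: the `(S,T)` entry is
`q^|S Δ T|`. -/
def Vdel4 : Matrix (Fin 14) (Fin 14) (Polynomial ℤ) :=
  Matrix.of fun i j => q ^ (symmDiff (delSets i) (delSets j)).card

theorem P_mul_top (M : Matrix (Fin 23) (Fin 23) (Polynomial ℤ)) (i : Fin 9) (j : Fin 23) :
    (Ppyr4 * M) (Fin.castAdd 14 i) j =
      M (Fin.castAdd 14 i) j - q * M (Fin.natAdd 9 (Fin.castAdd 5 i)) j := by
  have h : ∀ k : Fin 23, Ppyr4 (Fin.castAdd 14 i) k * M k j =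
      (if k = Fin.castAdd 14 i then M k j else 0) +
      (if k = Fin.natAdd 9 (Fin.castAdd 5 i) then -q * M k j else 0) := by
    intro k
    have hi := i.isLt
    simp only [Ppyr4, Matrix.of_apply, Fin.ext_iff, Fin.val_castAdd, Fin.val_natAdd]
    split_ifs <;> first | omega | simp
  rw [Matrix.mul_apply, Finset.sum_congr rfl (fun k _ => h k), Finset.sum_add_distrib,
    Finset.sum_ite_eq' Finset.univ, Finset.sum_ite_eq' Finset.univ]
  simp [sub_eq_add_neg]

theorem P_mul_bot (M : Matrix (Fin 23) (Fin 23) (Polynomial ℤ)) (i : Fin 14) (j : Fin 23) :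
    (Ppyr4 * M) (Fin.natAdd 9 i) j = M (Fin.natAdd 9 i) j := by
  have h : ∀ k : Fin 23, Ppyr4 (Fin.natAdd 9 i) k * M k j =
      (if k = Fin.natAdd 9 i then M k j else 0) := by
    intro k
    simp only [Ppyr4, Matrix.of_apply, Fin.ext_iff, Fin.val_natAdd]
    split_ifs <;> first | omega | simp
  rw [Matrix.mul_apply, Finset.sum_congr rfl (fun k _ => h k),
    Finset.sum_ite_eq' Finset.univ]
  simp

theorem PVP_eq : Ppyr4 * Vpyr4 * Ppyr4ᵀ = (Ppyr4 * (Ppyr4 * Vpyr4)ᵀ)ᵀ := by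
  rw [Matrix.transpose_mul, Matrix.transpose_transpose]

theorem card_tt : ∀ i j : Fin 9,
    (symmDiff (pyr4Sets (Fin.castAdd 14 i)) (pyr4Sets (Fin.castAdd 14 j))).card =
      (symmDiff (resSets i) (resSets j)).card := by decide +kernel

theorem card_tm : ∀ (i : Fin 9) (j : Fin 14),
    (symmDiff (pyr4Sets (Fin.castAdd 14 i)) (pyr4Sets (Fin.natAdd 9 j))).card =
      (symmDiff (delSets (Fin.castAdd 5 i)) (delSets j)).card + 1 := by decide +kernel

theorem card_mt : ∀ (i : Fin 14) (j : Fin 9),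
    (symmDiff (pyr4Sets (Fin.natAdd 9 i)) (pyr4Sets (Fin.castAdd 14 j))).card =
      (symmDiff (delSets i) (delSets (Fin.castAdd 5 j))).card + 1 := by decide +kernel

theorem card_mm : ∀ i j : Fin 14,
    (symmDiff (pyr4Sets (Fin.natAdd 9 i)) (pyr4Sets (Fin.natAdd 9 j))).card =
      (symmDiff (delSets i) (delSets j)).card := by decide +kernel

theorem card_rd : ∀ i j : Fin 9,
    (symmDiff (delSets (Fin.castAdd 5 i)) (delSets (Fin.castAdd 5 j))).card =
      (symmDiff (resSets i) (resSets j)).card := by decide +kernel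

/-- **Section 4.4.1.**  For the square-base pyramid arrangement,
`P V Pᵀ = diag((1-q²)·V′, V″)`, where `V′` is the `q`-Varchenko matrix of the
restricted arrangement in the base plane (the cyclic model `C₄`) and `V″` is the
`q`-Varchenko matrix of the deleted arrangement of the four side planes. -/
theorem pyramid4_deletion_restriction :
    Ppyr4 * Vpyr4 * Ppyr4ᵀ =
      Matrix.reindex finSumFinEquiv finSumFinEquiv
        (Matrix.fromBlocks ((1 - q ^ 2) • Vres4) 0 0 Vdel4) := by
  rw [PVP_eq]
  ext1 i j
  obtain ⟨i, rfl⟩ := (finSumFinEquiv (m := 9) (n := 14)).surjective i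
  obtain ⟨j, rfl⟩ := (finSumFinEquiv (m := 9) (n := 14)).surjective j
  rw [Matrix.reindex_apply, Matrix.submatrix_apply, Equiv.symm_apply_apply,
    Equiv.symm_apply_apply, Matrix.transpose_apply]
  rcases i with i | i <;> rcases j with j | j <;>
    simp only [finSumFinEquiv_apply_left, finSumFinEquiv_apply_right, P_mul_top, P_mul_bot,
      Matrix.transpose_apply, Vpyr4, Vres4, Vdel4, Matrix.of_apply, card_tt, card_tm, card_mt,
      card_mm, card_rd, Matrix.fromBlocks_apply₁₁, Matrix.fromBlocks_apply₁₂,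
      Matrix.fromBlocks_apply₂₁, Matrix.fromBlocks_apply₂₂, Matrix.smul_apply,
      Matrix.zero_apply, smul_eq_mul] <;> ring
end
end

section
/- Let V be the 23×23 matrix over ℤ[q] whose rows and columns are indexed by the following 23 subsets of {1,2,3,4,5}: {5},{1,5},{2,5},{3,5},{4,5},{1,2,5},{2,3,5},{3,4,5},{1,4,5}; ∅,{1},{2},{3},{4},{1,2},{2,3},{3,4},{1,4}; {1,2,3},{2,3,4},{1,3,4},{1,2,4},{1,2,3,4}; with (S,T) entry q^{|S Δ T|}. Then there exist unimodular 23×23 matrices M and N over ℤ[q] such that M V N = diag(1, (1−q²)·I_5, (1−q²)²·I_{10}, (1−q²)³·I_6, (1−q²)²(1−q^8)). In particular, the q-Varchenko matrix of the hyperplane arrangement of a pyramid with a square base has Smith normal form diag(1, (1−q²)I_5, (1−q²)²I_{10}, (1−q²)³I_6, (1−q²)²(1−q^8)) over ℤ[q]. -/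
open Matrix

noncomputable section

/-- The diagonal matrix
`diag(1, (1-q²)·I₅, (1-q²)²·I₁₀, (1-q²)³·I₆, (1-q²)²(1-q⁸))`. -/
def Dpyr4 : Matrix (Fin 23) (Fin 23) (Polynomial ℤ) :=
  Matrix.diagonal fun k =>
    if (k : ℕ) = 0 then 1
    else if (k : ℕ) ≤ 5 then 1 - q ^ 2
    else if (k : ℕ) ≤ 15 then (1 - q ^ 2) ^ 2
    else if (k : ℕ) ≤ 21 then (1 - q ^ 2) ^ 3
    else (1 - q ^ 2) ^ 2 * (1 - q ^ 8)

/-! ### Computable polynomials: coefficient lists, constant coefficient first, no trailing zeros -/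

/-- Evaluate a coefficient list. -/
def ev : List ℤ → Polynomial ℤ
  | [] => 0
  | a :: l => Polynomial.C a + Polynomial.X * ev l

/-- Prepend a coefficient, keeping the list free of trailing zeros. -/
def pcons (a : ℤ) : List ℤ → List ℤ
  | [] => if a = 0 then [] else [a]
  | b :: l => a :: b :: l

def padd : List ℤ → List ℤ → List ℤ
  | [], m => m
  | a :: l, [] => a :: l
  | a :: l, b :: m => pcons (a + b) (padd l m)

def psmul (a : ℤ) : List ℤ → List ℤ
  | [] => []
  | b :: l => pcons (a * b) (psmul a l)

def pmul : List ℤ → List ℤ → List ℤ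
  | [], _ => []
  | a :: l, m => padd (psmul a m) (pcons 0 (pmul l m))

lemma ev_pcons (a : ℤ) (l : List ℤ) : ev (pcons a l) = Polynomial.C a + Polynomial.X * ev l := by
  cases l with
  | nil =>
    by_cases h : a = 0 <;> simp [pcons, ev, h]
  | cons b l => rfl

lemma ev_padd (l m : List ℤ) : ev (padd l m) = ev l + ev m := by
  induction l generalizing m with
  | nil => simp [padd, ev]
  | cons a l ih =>
    cases m with
    | nil => simp [padd, ev]
    | cons b m =>
      simp only [padd, ev_pcons, ih, ev, Polynomial.C_add]
      ring

lemma ev_psmul (a : ℤ) (l : List ℤ) : ev (psmul a l) = Polynomial.C a * ev l := by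
  induction l with
  | nil => simp [psmul, ev]
  | cons b l ih =>
    simp only [psmul, ev_pcons, ih, ev, Polynomial.C_mul]
    ring

lemma ev_pmul (l m : List ℤ) : ev (pmul l m) = ev l * ev m := by
  induction l with
  | nil => simp [pmul, ev]
  | cons a l ih =>
    simp only [pmul, ev_padd, ev_psmul, ev_pcons, ih, ev, Polynomial.C_0]
    ring

lemma ev_mono (n : ℕ) : ev (List.replicate n 0 ++ [1]) = q ^ n := by
  induction n with
  | zero => simp [ev]
  | succ n ih =>
    rw [List.replicate_succ, List.cons_append, ev, ih, pow_succ', q]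
    simp

/-! ### Computable matrices and row operations -/

/-- `radd c r s` is the row `r + c • s`. -/
def radd (c : List ℤ) : List (List ℤ) → List (List ℤ) → List (List ℤ)
  | r, [] => r
  | [], y :: s => pmul c y :: radd c [] s
  | x :: r, y :: s => padd x (pmul c y) :: radd c r s

lemma ev_radd (c : List ℤ) (r s : List (List ℤ)) (k : ℕ) :
    ev ((radd c r s).getD k []) = ev (r.getD k []) + ev c * ev (s.getD k []) := by
  induction s generalizing r k with
  | nil => cases r <;> simp [radd, ev]
  | cons y s ih =>
    cases r with
    | nil =>
      cases k with
      | zero => simp [radd, ev, ev_pmul]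
      | succ k => simpa [radd, ev] using ih [] k
    | cons x r =>
      cases k with
      | zero => simp [radd, ev_padd, ev_pmul]
      | succ k => simpa [radd] using ih r k

/-- A row operation `(i, j, c)`: add `c` times row `j` to row `i`. -/
abbrev RowOp := Fin 23 × Fin 23 × List ℤ

def toMat (m : List (List (List ℤ))) : Matrix (Fin 23) (Fin 23) (Polynomial ℤ) :=
  Matrix.of fun i j => ev ((m.getD i []).getD j [])

def rowop (o : RowOp) (m : List (List (List ℤ))) : List (List (List ℤ)) :=
  m.set o.1 (radd o.2.2 (m.getD o.1 []) (m.getD o.2.1 []))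

def rowred : List RowOp → List (List (List ℤ)) → List (List (List ℤ))
  | [], m => m
  | o :: t, m => rowred t (rowop o m)

/-- The product of the transvections that realise a list of row operations. -/
def opsMat : List RowOp → Matrix (Fin 23) (Fin 23) (Polynomial ℤ)
  | [] => 1
  | o :: t => opsMat t * transvection o.1 o.2.1 (ev o.2.2)

lemma toMat_rowop (o : RowOp) (m : List (List (List ℤ))) (hm : m.length = 23) :
    toMat (rowop o m) = transvection o.1 o.2.1 (ev o.2.2) * toMat m := by
  obtain ⟨i, j, c⟩ := o
  ext1 a b
  by_cases h : a = i
  · subst h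
    rw [transvection_mul_apply_same]
    simp only [toMat, Matrix.of_apply, rowop]
    rw [← ev_radd]
    congr 2
    have : (a : ℕ) < m.length := by rw [hm]; exact a.2
    simp [List.getD, this]
  · rw [transvection_mul_apply_of_ne _ _ _ _ h]
    simp only [toMat, Matrix.of_apply, rowop]
    have : (i : ℕ) ≠ a := fun h' => h (Fin.ext h'.symm)
    simp [List.getD, this]

lemma toMat_rowred (L : List RowOp) (m : List (List (List ℤ))) (hm : m.length = 23) :
    toMat (rowred L m) = opsMat L * toMat m := by
  induction L generalizing m with
  | nil => simp [rowred, opsMat]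
  | cons o t ih =>
    rw [rowred, ih _ (by simp [rowop, hm]), toMat_rowop o m hm, opsMat, Matrix.mul_assoc]

lemma det_opsMat (L : List RowOp) (h : ∀ o ∈ L, o.1 ≠ o.2.1) : (opsMat L).det = 1 := by
  induction L with
  | nil => simp [opsMat]
  | cons o t ih =>
    rw [opsMat, Matrix.det_mul, ih fun o ho => h o (List.mem_cons_of_mem _ ho),
      det_transvection_of_ne _ _ (h o List.mem_cons_self), one_mul]

def ltrans (m : List (List (List ℤ))) : List (List (List ℤ)) :=
  (List.range 23).map fun j => m.map fun r => r.getD j []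

lemma toMat_ltrans (m : List (List (List ℤ))) : toMat (ltrans m) = (toMat m)ᵀ := by
  ext1 a b
  simp only [toMat, Matrix.of_apply, Matrix.transpose_apply, ltrans]
  congr 1
  have ha : (a : ℕ) < 23 := a.2
  by_cases hb : (b : ℕ) < m.length <;> simp [List.getD, ha, hb]

/-- Exchange of two rows (up to a sign), as three transvections. -/
def swapOps (L : List (Fin 23 × Fin 23)) : List RowOp :=
  L.flatMap fun p => [(p.1, p.2, [1]), (p.2, p.1, [-1]), (p.1, p.2, [1])]

/-! ### The data -/

/-- The exponents of the `q`-Varchenko matrix. -/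
def dist : List (List ℕ) :=
  [[0, 1, 1, 1, 1, 2, 2, 2, 2, 1, 2, 2, 2, 2, 3, 3, 3, 3, 4, 4, 4, 4, 5],
   [1, 0, 2, 2, 2, 1, 3, 3, 1, 2, 1, 3, 3, 3, 2, 4, 4, 2, 3, 5, 3, 3, 4],
   [1, 2, 0, 2, 2, 1, 1, 3, 3, 2, 3, 1, 3, 3, 2, 2, 4, 4, 3, 3, 5, 3, 4],
   [1, 2, 2, 0, 2, 3, 1, 1, 3, 2, 3, 3, 1, 3, 4, 2, 2, 4, 3, 3, 3, 5, 4],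
   [1, 2, 2, 2, 0, 3, 3, 1, 1, 2, 3, 3, 3, 1, 4, 4, 2, 2, 5, 3, 3, 3, 4],
   [2, 1, 1, 3, 3, 0, 2, 4, 2, 3, 2, 2, 4, 4, 1, 3, 5, 3, 2, 4, 4, 2, 3],
   [2, 3, 1, 1, 3, 2, 0, 2, 4, 3, 4, 2, 2, 4, 3, 1, 3, 5, 2, 2, 4, 4, 3],
   [2, 3, 3, 1, 1, 4, 2, 0, 2, 3, 4, 4, 2, 2, 5, 3, 1, 3, 4, 2, 2, 4, 3],
   [2, 1, 3, 3, 1, 2, 4, 2, 0, 3, 2, 4, 4, 2, 3, 5, 3, 1, 4, 4, 2, 2, 3],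
   [1, 2, 2, 2, 2, 3, 3, 3, 3, 0, 1, 1, 1, 1, 2, 2, 2, 2, 3, 3, 3, 3, 4],
   [2, 1, 3, 3, 3, 2, 4, 4, 2, 1, 0, 2, 2, 2, 1, 3, 3, 1, 2, 4, 2, 2, 3],
   [2, 3, 1, 3, 3, 2, 2, 4, 4, 1, 2, 0, 2, 2, 1, 1, 3, 3, 2, 2, 4, 2, 3],
   [2, 3, 3, 1, 3, 4, 2, 2, 4, 1, 2, 2, 0, 2, 3, 1, 1, 3, 2, 2, 2, 4, 3],
   [2, 3, 3, 3, 1, 4, 4, 2, 2, 1, 2, 2, 2, 0, 3, 3, 1, 1, 4, 2, 2, 2, 3],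
   [3, 2, 2, 4, 4, 1, 3, 5, 3, 2, 1, 1, 3, 3, 0, 2, 4, 2, 1, 3, 3, 1, 2],
   [3, 4, 2, 2, 4, 3, 1, 3, 5, 2, 3, 1, 1, 3, 2, 0, 2, 4, 1, 1, 3, 3, 2],
   [3, 4, 4, 2, 2, 5, 3, 1, 3, 2, 3, 3, 1, 1, 4, 2, 0, 2, 3, 1, 1, 3, 2],
   [3, 2, 4, 4, 2, 3, 5, 3, 1, 2, 1, 3, 3, 1, 2, 4, 2, 0, 3, 3, 1, 1, 2],
   [4, 3, 3, 3, 5, 2, 2, 4, 4, 3, 2, 2, 2, 4, 1, 1, 3, 3, 0, 2, 2, 2, 1],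
   [4, 5, 3, 3, 3, 4, 2, 2, 4, 3, 4, 2, 2, 2, 3, 1, 1, 3, 2, 0, 2, 2, 1],
   [4, 3, 5, 3, 3, 4, 4, 2, 2, 3, 2, 4, 2, 2, 3, 3, 1, 1, 2, 2, 0, 2, 1],
   [4, 3, 3, 5, 3, 2, 4, 4, 2, 3, 2, 2, 4, 2, 1, 3, 3, 1, 2, 2, 2, 0, 1],
   [5, 4, 4, 4, 4, 3, 3, 3, 3, 4, 3, 3, 3, 3, 2, 2, 2, 2, 1, 1, 1, 1, 0]]

def vList : List (List (List ℤ)) :=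
  dist.map fun r => r.map fun n => List.replicate n 0 ++ [1]

def rowOps : List RowOp :=
  [(0, 9, [0, -1]), (1, 9, [0, 0, -1]), (2, 9, [0, 0, -1]), (3, 9, [0, 0, -1]),
   (4, 9, [0, 0, -1]), (5, 9, [0, 0, 0, -1]), (6, 9, [0, 0, 0, -1]), (7, 9, [0, 0, 0, -1]),
   (8, 9, [0, 0, 0, -1]), (10, 9, [0, -1]), (11, 9, [0, -1]), (12, 9, [0, -1]), (13, 9, [0, -1]),
   (14, 9, [0, 0, -1]), (15, 9, [0, 0, -1]), (16, 9, [0, 0, -1]), (17, 9, [0, 0, -1]),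
   (18, 9, [0, 0, 0, -1]), (19, 9, [0, 0, 0, -1]), (20, 9, [0, 0, 0, -1]),
   (21, 9, [0, 0, 0, -1]), (22, 9, [0, 0, 0, 0, -1]), (1, 0, [0, -1]), (2, 0, [0, -1]),
   (3, 0, [0, -1]), (4, 0, [0, -1]), (5, 0, [0, 0, -1]), (6, 0, [0, 0, -1]), (7, 0, [0, 0, -1]),
   (8, 0, [0, 0, -1]), (4, 13, [0, -1]), (7, 13, [0, 0, -1]), (8, 13, [0, 0, -1]),
   (16, 13, [0, -1]), (17, 13, [0, -1]), (19, 13, [0, 0, -1]), (20, 13, [0, 0, -1]),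
   (21, 13, [0, 0, -1]), (22, 13, [0, 0, 0, -1]), (2, 11, [0, -1]), (5, 11, [0, 0, -1]),
   (6, 11, [0, 0, -1]), (14, 11, [0, -1]), (15, 11, [0, -1]), (18, 11, [0, 0, -1]),
   (19, 11, [0, 0, -1]), (21, 11, [0, 0, -1]), (22, 11, [0, 0, 0, -1]), (1, 10, [0, -1]),
   (5, 10, [0, 0, -1]), (8, 10, [0, 0, -1]), (14, 10, [0, -1]), (17, 10, [0, -1]),
   (18, 10, [0, 0, -1]), (20, 10, [0, 0, -1]), (21, 10, [0, 0, -1]), (22, 10, [0, 0, 0, -1]),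
   (3, 12, [0, -1]), (6, 12, [0, 0, -1]), (7, 12, [0, 0, -1]), (15, 12, [0, -1]),
   (16, 12, [0, -1]), (18, 12, [0, 0, -1]), (19, 12, [0, 0, -1]), (20, 12, [0, 0, -1]),
   (22, 12, [0, 0, 0, -1]), (5, 1, [0, -1]), (8, 1, [0, -1]), (6, 3, [0, -1]), (7, 3, [0, -1]),
   (5, 2, [0, -1]), (6, 2, [0, -1]), (7, 4, [0, -1]), (8, 4, [0, -1]), (8, 17, [0, -1]),
   (20, 17, [0, -1]), (21, 17, [0, -1]), (22, 17, [0, 0, -1]), (7, 16, [0, -1]),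
   (19, 16, [0, -1]), (20, 16, [0, -1]), (22, 16, [0, 0, -1]), (18, 20, [0, 0, -1]),
   (22, 20, [0, -1]), (5, 14, [0, -1]), (18, 14, [0, -1]), (21, 14, [0, -1]),
   (22, 14, [0, 0, -1]), (19, 21, [0, 0, -1]), (22, 21, [0, -1]), (6, 15, [0, -1]),
   (18, 15, [0, -1]), (19, 15, [0, -1]), (22, 15, [0, 0, -1]), (18, 22, [0, -1]),
   (22, 18, [0, -1]), (22, 19, [0, 0, 0, 0, 0, 1])]
  ++ swapOps [(0, 9), (1, 9), (2, 13), (3, 11), (4, 10), (5, 12), (6, 9), (7, 11), (8, 13), (9, 10), (10, 17), (11, 16), (12, 20), (13, 21), (17, 20), (20, 21)]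

def colOps : List RowOp :=
  [(0, 9, [0, -1]), (1, 9, [0, 0, -1]), (2, 9, [0, 0, -1]), (3, 9, [0, 0, -1]),
   (4, 9, [0, 0, -1]), (5, 9, [0, 0, 0, -1]), (6, 9, [0, 0, 0, -1]), (7, 9, [0, 0, 0, -1]),
   (8, 9, [0, 0, 0, -1]), (10, 9, [0, -1]), (11, 9, [0, -1]), (12, 9, [0, -1]), (13, 9, [0, -1]),
   (14, 9, [0, 0, -1]), (15, 9, [0, 0, -1]), (16, 9, [0, 0, -1]), (17, 9, [0, 0, -1]),
   (18, 9, [0, 0, 0, -1]), (19, 9, [0, 0, 0, -1]), (20, 9, [0, 0, 0, -1]),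
   (21, 9, [0, 0, 0, -1]), (22, 9, [0, 0, 0, 0, -1]), (1, 0, [0, -1]), (2, 0, [0, -1]),
   (3, 0, [0, -1]), (4, 0, [0, -1]), (5, 0, [0, 0, -1]), (6, 0, [0, 0, -1]), (7, 0, [0, 0, -1]),
   (8, 0, [0, 0, -1]), (4, 13, [0, -1]), (7, 13, [0, 0, -1]), (8, 13, [0, 0, -1]),
   (16, 13, [0, -1]), (17, 13, [0, -1]), (19, 13, [0, 0, -1]), (20, 13, [0, 0, -1]),
   (21, 13, [0, 0, -1]), (22, 13, [0, 0, 0, -1]), (2, 11, [0, -1]), (5, 11, [0, 0, -1]),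
   (6, 11, [0, 0, -1]), (14, 11, [0, -1]), (15, 11, [0, -1]), (18, 11, [0, 0, -1]),
   (19, 11, [0, 0, -1]), (21, 11, [0, 0, -1]), (22, 11, [0, 0, 0, -1]), (1, 10, [0, -1]),
   (5, 10, [0, 0, -1]), (8, 10, [0, 0, -1]), (14, 10, [0, -1]), (17, 10, [0, -1]),
   (18, 10, [0, 0, -1]), (20, 10, [0, 0, -1]), (21, 10, [0, 0, -1]), (22, 10, [0, 0, 0, -1]),
   (3, 12, [0, -1]), (6, 12, [0, 0, -1]), (7, 12, [0, 0, -1]), (15, 12, [0, -1]),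
   (16, 12, [0, -1]), (18, 12, [0, 0, -1]), (19, 12, [0, 0, -1]), (20, 12, [0, 0, -1]),
   (22, 12, [0, 0, 0, -1]), (5, 1, [0, -1]), (8, 1, [0, -1]), (6, 3, [0, -1]), (7, 3, [0, -1]),
   (5, 2, [0, -1]), (6, 2, [0, -1]), (7, 4, [0, -1]), (8, 4, [0, -1]), (8, 17, [0, -1]),
   (20, 17, [0, -1]), (21, 17, [0, -1]), (22, 17, [0, 0, -1]), (7, 16, [0, -1]),
   (19, 16, [0, -1]), (20, 16, [0, -1]), (22, 16, [0, 0, -1]), (18, 20, [0, 0, -1]),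
   (22, 20, [0, -1]), (5, 14, [0, -1]), (18, 14, [0, -1]), (21, 14, [0, -1]),
   (22, 14, [0, 0, -1]), (19, 21, [0, 0, -1]), (22, 21, [0, -1]), (6, 15, [0, -1]),
   (18, 15, [0, -1]), (19, 15, [0, -1]), (22, 15, [0, 0, -1]), (19, 18, [0, 0, 1]),
   (22, 18, [0, 0, 0, 1]), (19, 22, [0, -1]), (22, 19, [0, -1])]
  ++ swapOps [(0, 9), (1, 9), (2, 13), (3, 11), (4, 10), (5, 12), (6, 9), (7, 11), (8, 13), (9, 10), (10, 17), (11, 16), (12, 20), (13, 21), (17, 20), (20, 21)]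

def dEntry (k : Fin 23) : List ℤ :=
  if (k : ℕ) = 0 then [1]
  else if (k : ℕ) ≤ 5 then [1, 0, -1]
  else if (k : ℕ) ≤ 15 then [1, 0, -2, 0, 1]
  else if (k : ℕ) ≤ 21 then [1, 0, -3, 0, 3, 0, -1]
  else [1, 0, -2, 0, 1, 0, 0, 0, -1, 0, 2, 0, -1]

def dList : List (List (List ℤ)) :=
  (List.finRange 23).map fun i => (List.finRange 23).map fun j => if i = j then dEntry i else []

lemma vList_eq : ∀ i j : Fin 23, (vList.getD i []).getD j [] =
    List.replicate (symmDiff (pyr4Sets i) (pyr4Sets j)).card 0 ++ [1] := by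
  decide +kernel

lemma dList_eq : ∀ i j : Fin 23, (dList.getD i []).getD j [] = if i = j then dEntry i else [] := by
  decide +kernel

lemma red_eq : rowred colOps (ltrans (rowred rowOps vList)) = dList := by
  decide +kernel

lemma toMat_vList : toMat vList = Vpyr4 := by
  ext1 i j
  simp only [toMat, Matrix.of_apply, Vpyr4, vList_eq, ev_mono]

lemma ev_dEntry (k : Fin 23) : ev (dEntry k) =
    if (k : ℕ) = 0 then 1
    else if (k : ℕ) ≤ 5 then 1 - q ^ 2
    else if (k : ℕ) ≤ 15 then (1 - q ^ 2) ^ 2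
    else if (k : ℕ) ≤ 21 then (1 - q ^ 2) ^ 3
    else (1 - q ^ 2) ^ 2 * (1 - q ^ 8) := by
  unfold dEntry
  split_ifs <;> simp [ev, q] <;> ring

lemma toMat_dList : toMat dList = Dpyr4 := by
  ext1 i j
  simp only [toMat, Matrix.of_apply, Dpyr4, dList_eq, Matrix.diagonal_apply]
  by_cases h : i = j
  · rw [if_pos h, if_pos h, ev_dEntry]
  · rw [if_neg h, if_neg h, ev]


/-- **Section 4.4.1.**  The `q`-Varchenko matrix of the hyperplane arrangement of a
pyramid with a square base has Smith normal form
`diag(1, (1-q²)I₅, (1-q²)²I₁₀, (1-q²)³I₆, (1-q²)²(1-q⁸))` over `ℤ[q]`,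
realized by unimodular matrices `M, N` with `M V N` equal to this diagonal matrix. -/
theorem pyramid4_snf :
    ∃ M N : Matrix (Fin 23) (Fin 23) (Polynomial ℤ),
      (M.det = 1 ∨ M.det = -1) ∧ (N.det = 1 ∨ N.det = -1) ∧
        M * Vpyr4 * N = Dpyr4 := by
  refine ⟨opsMat rowOps, (opsMat colOps)ᵀ, Or.inl ?_, Or.inl ?_, ?_⟩
  · exact det_opsMat _ (by decide +kernel)
  · rw [Matrix.det_transpose]
    exact det_opsMat _ (by decide +kernel)
  · have h := congrArg toMat red_eq
    rw [toMat_rowred _ _ (by simp [ltrans]), toMat_ltrans,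
      toMat_rowred _ _ (by decide +kernel), toMat_vList, toMat_dList] at h
    have h2 := congrArg Matrix.transpose h
    rw [Matrix.transpose_mul, Matrix.transpose_transpose] at h2
    rw [h2, Dpyr4, Matrix.diagonal_transpose]
end
end

section
/- Let L be the ordered list of 16 subsets of {1,2,3,4,5}: ∅,{1},{2},{3},{4},{5},{1,2},{2,3},{3,4},{4,5},{1,5},{1,2,3},{2,3,4},{3,4,5},{1,4,5},{1,2,5}. Let V be the 38×38 matrix over ℤ[q] whose rows and columns are indexed, in order, by: S ∪ {6} for S running through L; then S running through L; then {1,2,3,4},{2,3,4,5},{1,3,4,5},{1,2,4,5},{1,2,3,5},{1,2,3,4,5}; with (S,T) entry q^{|S Δ T|}. Let P be the 38×38 block matrix P = [[I_{16}, −q·I_{16}, 0],[0, I_{16}, 0],[0, 0, I_6]]. Then P V P^t is the block diagonal matrix diag((1−q²)·V′, V″), where V′ is the 16×16 matrix indexed by L with (S,T) entry q^{|S Δ T|} (which equals the q-Varchenko matrix of the cyclic model C_5), and V″ is the 22×22 matrix indexed by L followed by {1,2,3,4},{2,3,4,5},{1,3,4,5},{1,2,4,5},{1,2,3,5},{1,2,3,4,5}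 with (S,T) entry q^{|S Δ T|}. -/
open Matrix

noncomputable section

/-- The ordered list `L` of `16` subsets of `{1,…,5}` (rendered as `Fin 5 = {0,…,4}`):
`∅, 1, 2, 3, 4, 5, 12, 23, 34, 45, 15, 123, 234, 345, 145, 125`. -/
def Lsets : Fin 16 → Finset (Fin 5) :=
  ![∅, {0}, {1}, {2}, {3}, {4},
    {0, 1}, {1, 2}, {2, 3}, {3, 4}, {0, 4},
    {0, 1, 2}, {1, 2, 3}, {2, 3, 4}, {0, 3, 4}, {0, 1, 4}]

/-- The `38` subsets of `{1,…,6}` (rendered as `Fin 6 = {0,…,5}`, the base plane `h₆`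
being `5`) indexing the regions of the pentagonal-base pyramid arrangement, in order:
`S ∪ {6}` for `S` running through `L`; then `S` running through `L`; then
`1234, 2345, 1345, 1245, 1235, 12345`. -/
def pyr5Sets : Fin 38 → Finset (Fin 6) :=
  ![{5}, {0, 5}, {1, 5}, {2, 5}, {3, 5}, {4, 5},
    {0, 1, 5}, {1, 2, 5}, {2, 3, 5}, {3, 4, 5}, {0, 4, 5},
    {0, 1, 2, 5}, {1, 2, 3, 5}, {2, 3, 4, 5}, {0, 3, 4, 5}, {0, 1, 4, 5},
    ∅, {0}, {1}, {2}, {3}, {4},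
    {0, 1}, {1, 2}, {2, 3}, {3, 4}, {0, 4},
    {0, 1, 2}, {1, 2, 3}, {2, 3, 4}, {0, 3, 4}, {0, 1, 4},
    {0, 1, 2, 3}, {1, 2, 3, 4}, {0, 2, 3, 4}, {0, 1, 3, 4}, {0, 1, 2, 4},
    {0, 1, 2, 3, 4}]

/-- The `q`-Varchenko matrix of the pentagonal-base pyramid arrangement: the `(S,T)`
entry is `q^|S Δ T|`. -/
def Vpyr5 : Matrix (Fin 38) (Fin 38) (Polynomial ℤ) :=
  Matrix.of fun i j => q ^ (symmDiff (pyr5Sets i) (pyr5Sets j)).card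

/-- The block matrix `P = [[I₁₆, -q·I₁₆, 0], [0, I₁₆, 0], [0, 0, I₆]]`. -/
def Ppyr5 : Matrix (Fin 38) (Fin 38) (Polynomial ℤ) :=
  Matrix.of fun i j =>
    if i = j then 1
    else if (i : ℕ) < 16 ∧ (j : ℕ) = (i : ℕ) + 16 then -q
    else 0

/-- The `q`-Varchenko matrix `V′` of the restricted arrangement in `h₆` (the cyclic
model `C₅`), indexed by `L`: the `(S,T)` entry is `q^|S Δ T|`. -/
def Vres5 : Matrix (Fin 16) (Fin 16) (Polynomial ℤ) :=
  Matrix.of fun i j => q ^ (symmDiff (Lsets i) (Lsets j)).card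

/-- The `22` subsets of `{1,…,5}` (as `Fin 5`) indexing the regions of the deleted
arrangement (the five side planes): `L` followed by `1234, 2345, 1345, 1245, 1235,
12345`. -/
def delSets5 : Fin 22 → Finset (Fin 5) :=
  ![∅, {0}, {1}, {2}, {3}, {4},
    {0, 1}, {1, 2}, {2, 3}, {3, 4}, {0, 4},
    {0, 1, 2}, {1, 2, 3}, {2, 3, 4}, {0, 3, 4}, {0, 1, 4},
    {0, 1, 2, 3}, {1, 2, 3, 4}, {0, 2, 3, 4}, {0, 1, 3, 4}, {0, 1, 2, 4},
    {0, 1, 2, 3, 4}]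

/-- The `q`-Varchenko matrix `V″` of the deleted arrangement: the `(S,T)` entry is
`q^|S Δ T|`. -/
def Vdel5 : Matrix (Fin 22) (Fin 22) (Polynomial ℤ) :=
  Matrix.of fun i j => q ^ (symmDiff (delSets5 i) (delSets5 j)).card

/-- Subsets of the side planes as subsets of all six planes. -/
lemma pyr5_nat : ∀ c : Fin 22, pyr5Sets (Fin.natAdd 16 c) = (delSets5 c).map Fin.castSuccEmb := by
  decide

lemma pyr5_cast : ∀ a : Fin 16, pyr5Sets (Fin.castAdd 22 a) =
    insert 5 ((delSets5 (Fin.castAdd 6 a)).map Fin.castSuccEmb) := by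
  decide

lemma L_eq : ∀ a : Fin 16, Lsets a = delSets5 (Fin.castAdd 6 a) := by
  decide

lemma card_nn : ∀ S T : Finset (Fin 5),
    (symmDiff (S.map Fin.castSuccEmb) (T.map Fin.castSuccEmb)).card = (symmDiff S T).card := by
  intro S T
  rw [Finset.map_eq_image, Finset.map_eq_image,
    ← Finset.image_symmDiff _ _ Fin.castSuccEmb.injective,
    Finset.card_image_of_injective _ Fin.castSuccEmb.injective]

lemma five_notMem (S : Finset (Fin 5)) : (5 : Fin 6) ∉ S.map Fin.castSuccEmb := by
  intro h
  obtain ⟨x, -, hx⟩ := Finset.mem_map.1 h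
  exact Fin.castSucc_ne_last x hx

lemma card_cn (S T : Finset (Fin 5)) :
    (symmDiff (insert 5 (S.map Fin.castSuccEmb)) (T.map Fin.castSuccEmb)).card
      = (symmDiff S T).card + 1 := by
  have hS := five_notMem S
  have hT := five_notMem T
  have : symmDiff (insert 5 (S.map Fin.castSuccEmb)) (T.map Fin.castSuccEmb)
      = insert 5 (symmDiff (S.map Fin.castSuccEmb) (T.map Fin.castSuccEmb)) := by
    ext x
    by_cases hx : x = 5
    · subst hx; simp only [Finset.mem_symmDiff, Finset.mem_insert]; tauto
    · simp only [Finset.mem_symmDiff, Finset.mem_insert]; tauto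
  rw [this, Finset.card_insert_of_notMem, card_nn]
  simp only [Finset.mem_symmDiff]; tauto

lemma card_cc (S T : Finset (Fin 5)) :
    (symmDiff (insert 5 (S.map Fin.castSuccEmb)) (insert 5 (T.map Fin.castSuccEmb))).card
      = (symmDiff S T).card := by
  have hS := five_notMem S
  have hT := five_notMem T
  rw [← card_nn S T]
  congr 1
  ext x
  by_cases hx : x = 5
  · subst hx; simp only [Finset.mem_symmDiff, Finset.mem_insert]; tauto
  · simp only [Finset.mem_symmDiff, Finset.mem_insert]; tauto

lemma P_cast (a : Fin 16) (k : Fin 38) : Ppyr5 (Fin.castAdd 22 a) k =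
    (if k = Fin.castAdd 22 a then 1 else 0)
      + (if k = Fin.natAdd 16 (Fin.castAdd 6 a) then -q else 0) := by
  have := a.2
  simp only [Ppyr5, Matrix.of_apply, Fin.ext_iff, Fin.val_castAdd, Fin.val_natAdd]
  split_ifs <;> first | omega | simp

lemma P_nat (c : Fin 22) (k : Fin 38) : Ppyr5 (Fin.natAdd 16 c) k =
    (if k = Fin.natAdd 16 c then 1 else 0) := by
  simp only [Ppyr5, Matrix.of_apply, Fin.ext_iff, Fin.val_natAdd]
  split_ifs <;> first | omega | simp

lemma mul_cast (M : Matrix (Fin 38) (Fin 38) (Polynomial ℤ)) (a : Fin 16) (j : Fin 38) :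
    (Ppyr5 * M) (Fin.castAdd 22 a) j =
      M (Fin.castAdd 22 a) j - q * M (Fin.natAdd 16 (Fin.castAdd 6 a)) j := by
  simp only [Matrix.mul_apply, P_cast, add_mul, Finset.sum_add_distrib, ite_mul, zero_mul,
    one_mul, Finset.sum_ite_eq', Finset.mem_univ, if_true]
  ring

lemma mul_nat (M : Matrix (Fin 38) (Fin 38) (Polynomial ℤ)) (c : Fin 22) (j : Fin 38) :
    (Ppyr5 * M) (Fin.natAdd 16 c) j = M (Fin.natAdd 16 c) j := by
  simp only [Matrix.mul_apply, P_nat, ite_mul, zero_mul,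
    one_mul, Finset.sum_ite_eq', Finset.mem_univ, if_true]

lemma mulT_cast (M : Matrix (Fin 38) (Fin 38) (Polynomial ℤ)) (a : Fin 16) (j : Fin 38) :
    (M * Ppyr5ᵀ) j (Fin.castAdd 22 a) =
      M j (Fin.castAdd 22 a) - q * M j (Fin.natAdd 16 (Fin.castAdd 6 a)) := by
  have := mul_cast Mᵀ a j
  rwa [← Matrix.transpose_transpose Ppyr5, ← Matrix.transpose_mul] at this

lemma mulT_nat (M : Matrix (Fin 38) (Fin 38) (Polynomial ℤ)) (c : Fin 22) (j : Fin 38) :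
    (M * Ppyr5ᵀ) j (Fin.natAdd 16 c) = M j (Fin.natAdd 16 c) := by
  have := mul_nat Mᵀ c j
  rwa [← Matrix.transpose_transpose Ppyr5, ← Matrix.transpose_mul] at this

lemma V_cc (a b : Fin 16) : Vpyr5 (Fin.castAdd 22 a) (Fin.castAdd 22 b) = Vres5 a b := by
  simp only [Vpyr5, Vres5, Matrix.of_apply, pyr5_cast, L_eq, card_cc]

lemma V_nn (c d : Fin 22) : Vpyr5 (Fin.natAdd 16 c) (Fin.natAdd 16 d) = Vdel5 c d := by
  simp only [Vpyr5, Vdel5, Matrix.of_apply, pyr5_nat, card_nn]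

lemma V_cn (a : Fin 16) (d : Fin 22) :
    Vpyr5 (Fin.castAdd 22 a) (Fin.natAdd 16 d) = q * Vdel5 (Fin.castAdd 6 a) d := by
  simp only [Vpyr5, Vdel5, Matrix.of_apply, pyr5_cast, pyr5_nat, card_cn, pow_succ']

lemma V_nc (a : Fin 16) (d : Fin 22) :
    Vpyr5 (Fin.natAdd 16 d) (Fin.castAdd 22 a) = q * Vdel5 d (Fin.castAdd 6 a) := by
  have := V_cn a d
  simp only [Vpyr5, Vdel5, Matrix.of_apply] at this ⊢
  rwa [symmDiff_comm, symmDiff_comm (delSets5 d)]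

lemma Vdel_res (a b : Fin 16) :
    Vdel5 (Fin.castAdd 6 a) (Fin.castAdd 6 b) = Vres5 a b := by
  simp only [Vdel5, Vres5, Matrix.of_apply, L_eq]

/-- **Section 4.4.2.**  For the pentagonal-base pyramid arrangement,
`P V Pᵀ = diag((1-q²)·V′, V″)`, where `V′` is the `q`-Varchenko matrix of the
restricted arrangement in the base plane (the cyclic model `C₅`) and `V″` is the
`q`-Varchenko matrix of the deleted arrangement of the five side planes. -/
theorem pyramid5_deletion_restriction :
    Ppyr5 * Vpyr5 * Ppyr5ᵀ =
      Matrix.reindex finSumFinEquiv finSumFinEquiv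
        (Matrix.fromBlocks ((1 - q ^ 2) • Vres5) 0 0 Vdel5) := by
  ext1 i j
  obtain ⟨i, rfl⟩ := (finSumFinEquiv (m := 16) (n := 22)).surjective i
  obtain ⟨j, rfl⟩ := (finSumFinEquiv (m := 16) (n := 22)).surjective j
  rw [Matrix.reindex_apply, Matrix.submatrix_apply, Equiv.symm_apply_apply,
    Equiv.symm_apply_apply]
  rcases i with a | c <;> rcases j with b | d
  · rw [finSumFinEquiv_apply_left, finSumFinEquiv_apply_left, mulT_cast, mul_cast, mul_cast,
      V_cc, V_nc, V_cn, V_nn, Vdel_res, Matrix.fromBlocks_apply₁₁, Matrix.smul_apply,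
      smul_eq_mul]
    ring
  · rw [finSumFinEquiv_apply_left, finSumFinEquiv_apply_right, mulT_nat, mul_cast,
      V_cn, V_nn, Matrix.fromBlocks_apply₁₂, Matrix.zero_apply]
    ring
  · rw [finSumFinEquiv_apply_left, finSumFinEquiv_apply_right, mulT_cast, mul_nat, mul_nat,
      V_nc, V_nn, Matrix.fromBlocks_apply₂₁, Matrix.zero_apply]
    ring
  · rw [finSumFinEquiv_apply_right, finSumFinEquiv_apply_right, mulT_nat, mul_nat,
      V_nn, Matrix.fromBlocks_apply₂₂]
end
end
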